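/- arXiv:2105.09197 — 2 statements merged into one kernel-verified Lean document; each statement's English description precedes it below -/
import Mathlib

section
/- Let A ∈ 𝒮ⁿ[k] be a Robinson matrix. If A has a uniform embedding with respect to some threshold vector, then there exist a threshold vector d ∈ 𝔻ᵏ and a strictly monotone increasing map Π : [n] → ℝ such that for all pairs u < v in [n] and all t ∈ {0,…,k}: a_{u,v} = t if and only if d_{t+1} < Π(v) − Π(u) < d_t, where by convention d_0 = +∞ and d_{k+1} = 0. -/
/-- The standard unit vector `χ_t ∈ ℤᵏ` (as a function `ℕ → ℤ`, supported on index `t`). -/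
def chi (t : ℕ) : ℕ → ℤ := fun i => if i = t then 1 else 0

/-- The dot product `bᵀ d = Σ_{i=1}^k b_i d_i`. -/
def dotProd (k : ℕ) (b : ℕ → ℤ) (d : ℕ → ℝ) : ℝ :=
  ∑ i ∈ Finset.Icc 1 k, (b i : ℝ) * d i

/-- `A ∈ 𝒮ⁿ[k]`: a symmetric matrix with entries in `{0,…,k}`, diagonal `k`,
entries increasing towards the diagonal. -/
def IsRobinson (n k : ℕ) (a : Fin n → Fin n → ℕ) : Prop :=
  (∀ u v, a u v = a v u) ∧ (∀ u, a u u = k) ∧ (∀ u v, a u v ≤ k) ∧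
    ∀ u v w : Fin n, u < v → v < w → a u w ≤ a u v ∧ a u w ≤ a v w

/-- `d ∈ 𝔻ᵏ`: threshold vectors with `d 1 > d 2 > ⋯ > d k > 0`
(values outside `{1,…,k}` are irrelevant). -/
def IsThreshold (k : ℕ) (d : ℕ → ℝ) : Prop :=
  (∀ i, 1 ≤ i → i < k → d (i + 1) < d i) ∧ 0 < d k

/-- Uniform embedding: for all pairs `u,v` and all `t ≤ k`,
`a u v = t ↔ d_{t+1} < |f v − f u| ≤ d_t`, with conventions `d_0 = +∞`, `d_{k+1} = −∞`. -/
def IsUnifEmb (n k : ℕ) (a : Fin n → Fin n → ℕ) (d : ℕ → ℝ)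
    (f : Fin n → ℝ) : Prop :=
  ∀ u v : Fin n, ∀ t : ℕ, t ≤ k →
    (a u v = t ↔ (t = k ∨ d (t + 1) < |f v - f u|) ∧ (t = 0 ∨ |f v - f u| ≤ d t))

/-- The strict inequality system: for all `u < v` and all `t ≤ k`,
`a u v = t ↔ d_{t+1} < f v − f u < d_t`, with conventions `d_0 = +∞`, `d_{k+1} = 0`. -/
def SatisfiesStrict (n k : ℕ) (a : Fin n → Fin n → ℕ) (d : ℕ → ℝ)
    (f : Fin n → ℝ) : Prop :=
  ∀ u v : Fin n, u < v → ∀ t : ℕ, t ≤ k →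
    (a u v = t ↔ ((if t = k then (0 : ℝ) else d (t + 1)) < f v - f u) ∧
      (t = 0 ∨ f v - f u < d t))

/-- `β⁺(x,y)`: for `x < y`, `β⁺(x,y) = χ_{a x y}` (junk value `χ_0` when `a x y = 0`,
where it is undefined); for `x > y`, `β⁺(x,y) = −β⁻(y,x)`. -/
def betaP {n : ℕ} (k : ℕ) (a : Fin n → Fin n → ℕ) (x y : Fin n) : ℕ → ℤ :=
  if x < y then chi (a x y)
  else if y < x then (if a x y = k then 0 else -chi (a x y + 1))
  else 0

/-- `β⁻(x,y)`: for `x < y`, `β⁻(x,y) = χ_{a x y + 1}` if `a x y < k` and `0` if `a x y = k`;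
for `x > y`, `β⁻(x,y) = −β⁺(y,x)`. -/
def betaM {n : ℕ} (k : ℕ) (a : Fin n → Fin n → ℕ) (x y : Fin n) : ℕ → ℤ :=
  if x < y then (if a x y = k then 0 else chi (a x y + 1))
  else if y < x then -chi (a x y)
  else 0

/-- `β⁺(W) = Σ_i β⁺(w_{i−1}, w_i)` over the steps of the walk `W`. -/
def betaPWalk {n : ℕ} (k : ℕ) (a : Fin n → Fin n → ℕ) (w : List (Fin n)) : ℕ → ℤ :=
  ((w.zip w.tail).map fun p => betaP k a p.1 p.2).sum

/-- `β⁻(W) = Σ_i β⁻(w_{i−1}, w_i)` over the steps of the walk `W`. -/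
def betaMWalk {n : ℕ} (k : ℕ) (a : Fin n → Fin n → ℕ) (w : List (Fin n)) : ℕ → ℤ :=
  ((w.zip w.tail).map fun p => betaM k a p.1 p.2).sum

/-- A `(u,v)`-upper-bound-walk: a walk from `u` to `v` with consecutive entries distinct,
in which every increasing step is an edge (`a x y ≥ 1`). -/
def IsUBWalk {n : ℕ} (a : Fin n → Fin n → ℕ) (u v : Fin n) (w : List (Fin n)) : Prop :=
  w.head? = some u ∧ w.getLast? = some v ∧
    List.Chain' (fun x y => x ≠ y ∧ (x < y → 1 ≤ a x y)) w

/-- A `(u,v)`-lower-bound-walk: a walk from `u` to `v` with consecutive entries distinct,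
in which every decreasing step is an edge (`a x y ≥ 1`). -/
def IsLBWalk {n : ℕ} (a : Fin n → Fin n → ℕ) (u v : Fin n) (w : List (Fin n)) : Prop :=
  w.head? = some u ∧ w.getLast? = some v ∧
    List.Chain' (fun x y => x ≠ y ∧ (y < x → 1 ≤ a x y)) w

/-- An upper-bound-cycle: a `(u,u)`-upper-bound-walk of length `p ≥ 2` in which
`u = w_0 = w_p` is the only repeated vertex. -/
def IsUBCycle {n : ℕ} (a : Fin n → Fin n → ℕ) (w : List (Fin n)) : Prop :=
  ∃ u : Fin n, IsUBWalk a u u w ∧ 3 ≤ w.length ∧ w.dropLast.Nodup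

/-- The path condition for `A` and `d`: for all `u < v`, every `(u,v)`-upper-bound-path `W₁`
and every `(u,v)`-lower-bound-path `W₂` satisfy `β⁻(W₂)ᵀ d < β⁺(W₁)ᵀ d`. -/
def PathCondition (n k : ℕ) (a : Fin n → Fin n → ℕ) (d : ℕ → ℝ) : Prop :=
  ∀ u v : Fin n, u < v → ∀ w₁ w₂ : List (Fin n),
    IsUBWalk a u v w₁ → w₁.Nodup → IsLBWalk a u v w₂ → w₂.Nodup →
      dotProd k (betaMWalk k a w₂) d < dotProd k (betaPWalk k a w₁) d

/-- The prefix-sum partial order `⪯` on `ℤᵏ`. -/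
def Preceq (k : ℕ) (x y : ℕ → ℤ) : Prop :=
  ∀ t, 1 ≤ t → t ≤ k → ∑ i ∈ Finset.Icc 1 t, x i ≤ ∑ i ∈ Finset.Icc 1 t, y i

/-- One-directional form of the embedding condition. -/
def EmbQ (n k : ℕ) (a : Fin n → Fin n → ℕ) (d : ℕ → ℝ) (f : Fin n → ℝ) : Prop :=
  ∀ u v : Fin n, (a u v = k ∨ d (a u v + 1) < |f v - f u|) ∧ (a u v = 0 ∨ |f v - f u| ≤ d (a u v))

lemma thr_anti {k : ℕ} {d : ℕ → ℝ} (hd : IsThreshold k d) {s t : ℕ} (hs : 1 ≤ s) (hst : s ≤ t)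
    (ht : t ≤ k) : d t ≤ d s := by
  induction t, hst using Nat.le_induction with
  | base => exact le_rfl
  | succ t hst ih => exact (hd.1 t (by omega) (by omega)).le.trans (ih (by omega))

lemma emb_mono {n k : ℕ} {a : Fin n → Fin n → ℕ} {d : ℕ → ℝ} {f : Fin n → ℝ}
    (hd : IsThreshold k d) (hk : ∀ u v, a u v ≤ k) (hf : EmbQ n k a d f) {u v x y : Fin n}
    (h : |f v - f u| ≤ |f y - f x|) : a x y ≤ a u v := by
  by_contra hc
  push Not at hc
  have h1 := (hf u v).1
  have h2 := (hf x y).2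
  have := hk x y
  have h3 := thr_anti hd (s := a u v + 1) (t := a x y) (by omega) (by omega) this
  rcases h1 with h1 | h1
  · omega
  rcases h2 with h2 | h2
  · omega
  linarith

lemma emb_rob {n k : ℕ} {a : Fin n → Fin n → ℕ} {d : ℕ → ℝ} {f : Fin n → ℝ}
    (hd : IsThreshold k d) (hk : ∀ u v, a u v ≤ k) (hf : EmbQ n k a d f) {u v w : Fin n}
    (h1 : f u ≤ f v) (h2 : f v ≤ f w) : a u w ≤ a u v ∧ a u w ≤ a v w := by
  constructor <;> apply emb_mono hd hk hf
  · rw [abs_of_nonneg (by linarith), abs_of_nonneg (by linarith)]; linarith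
  · rw [abs_of_nonneg (by linarith), abs_of_nonneg (by linarith)]; linarith

/-- Reflecting a module `B` inside the interval hull of its image. -/
lemma emb_reflect {n k : ℕ} {a : Fin n → Fin n → ℕ} {d : ℕ → ℝ} {f : Fin n → ℝ}
    (hs : ∀ u v, a u v = a v u)
    (hf : EmbQ n k a d f) (B : Fin n → Prop) [DecidablePred B] (x z : Fin n)
    (hB : ∀ b, B b → f x ≤ f b ∧ f b ≤ f z)
    (hout : ∀ y, ¬ B y → f y ≤ f x ∨ f z ≤ f y)
    (hx : B x) (hz : B z)
    (hmod : ∀ y b, ¬ B y → B b → a b y = a x y) :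
    EmbQ n k a d (fun v => if B v then f x + f z - f v else f v) := by
  have key : ∀ b y, B b → ¬ B y → (a b y = k ∨ d (a b y + 1) < |f y - (f x + f z - f b)|) ∧
      (a b y = 0 ∨ |f y - (f x + f z - f b)| ≤ d (a b y)) := by
    intro b y hb hy
    have h1 := hf x y
    have h2 := hf z y
    rw [hmod y z hy hz] at h2
    rw [hmod y b hy hb]
    have hbb := hB b hb
    rcases hout y hy with h | h
    · rw [abs_of_nonpos (by linarith)] at h1 h2 ⊢
      refine ⟨h1.1.imp id fun h => by linarith, h2.2.imp id fun h => by linarith⟩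
    · rw [abs_of_nonneg (by linarith)] at h1 h2 ⊢
      refine ⟨h2.1.imp id fun h => by linarith, h1.2.imp id fun h => by linarith⟩
  intro u v
  by_cases hu : B u <;> by_cases hv : B v <;> simp only [hu, hv, if_true, if_false]
  · have := hf u v
    rwa [show f x + f z - f v - (f x + f z - f u) = -(f v - f u) by ring, abs_neg]
  · exact key u v hu hv
  · have := key v u hv hu
    rwa [hs u v, abs_sub_comm]
  · exact hf u v

/-- One improvement step. -/
lemma emb_step {n k : ℕ} {a : Fin n → Fin n → ℕ} {d : ℕ → ℝ} {f : Fin n → ℝ}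
    (hA : IsRobinson n k a) (hd : IsThreshold k d) (hf : EmbQ n k a d f) (c x : Fin n)
    (hpre : ∀ i j, i < c → i < j → f i ≤ f j) (hcx : c < x) (hx : ∀ j, c ≤ j → f x ≤ f j)
    (hlt : f x < f c) :
    ∃ (g : Fin n → ℝ) (z : Fin n), EmbQ n k a d g ∧ (∀ i j, i < c → i < j → g i ≤ g j) ∧
      c ≤ z ∧ z < x ∧ ∀ j, c ≤ j → g z ≤ g j := by
  classical
  obtain ⟨hs, -, hk, hR⟩ := hA
  have rob := fun {u v w : Fin n} => @emb_rob n k a d f hd hk hf u v w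
  let S : Finset (Fin n) := Finset.univ.filter fun z =>
    z = c ∨ (f c < f z ∧ ∀ w, f c < f w → f w ≤ f z → w < x)
  obtain ⟨z, hzS, hzmax⟩ := S.exists_max_image f ⟨c, by simp [S]⟩
  have hzS : z = c ∨ (f c < f z ∧ ∀ w, f c < f w → f w ≤ f z → w < x) := by
    simpa [S] using hzS
  have hcS : f c ≤ f z := hzmax c (by simp [S])
  have hzprop : ∀ w, f c < f w → f w ≤ f z → w < x := by
    rcases hzS with h | h
    · subst h; intro w h1 h2; exact absurd h1 (not_lt.2 h2)
    · exact h.2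
  have hzx : z < x := by
    rcases hzS with h | h
    · rwa [h]
    · exact hzprop z h.1 le_rfl
  have hlow : ∀ i, i < c → f i ≤ f x := fun i hi => hpre i x hi (hi.trans hcx)
  have hge : ∀ w, f x < f w → c ≤ w := by
    intro w hw
    by_contra h
    exact absurd (hlow w (not_le.1 h)) (not_le.2 hw)
  have hcz : c ≤ z := hge z (by linarith)
  let B : Fin n → Prop := fun w => c ≤ w ∧ f w ≤ f z
  have hmodlow1 : ∀ i w, i < c → c ≤ w → f w ≤ f c → a i w = a i c := by
    intro i w hi hw hwc
    apply le_antisymm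
    · rcases hw.eq_or_lt with h | h
      · rw [h]
      · exact (hR i c w hi h).1
    · exact (rob ((hlow i hi).trans (hx w hw)) hwc).1
  have hmodlow : ∀ i w, i < c → c ≤ w → f w ≤ f z → a i w = a i c := by
    intro i w hi hw hwz
    rcases le_or_gt (f w) (f c) with h | h
    · exact hmodlow1 i w hi hw h
    · have hwx := hzprop w h hwz
      have e := hmodlow1 i x hi hcx.le hlt.le
      apply le_antisymm
      · rcases hw.eq_or_lt with h | h
        · rw [h]
        · exact (hR i c w hi h).1
      · rw [← e]; exact (hR i w x (hi.trans_le hw) hwx).1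
  have hmodhi : ∀ y, f z < f y → a z y ≤ a x y := by
    intro y hy
    by_contra hc
    push Not at hc
    have hyx : y < x := by
      by_contra h
      rcases (not_lt.1 h).eq_or_lt with h | h
      · rw [← h] at hy; linarith
      · exact absurd (hR z x y hzx h).2 (not_le.2 hc)
    have hyS : y ∈ S := by
      simp only [S, Finset.mem_filter, Finset.mem_univ, true_and]
      refine Or.inr ⟨by linarith, fun w h1 h2 => ?_⟩
      rcases le_or_gt (f w) (f z) with h3 | h3
      · exact hzprop w h1 h3
      · have h4 := (rob h3.le h2).2
        by_contra h
        rcases (not_lt.1 h).eq_or_lt with h | h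
        · rw [← h] at h1; linarith
        · have h5 := (hR y x w hyx h).1
          rw [hs y w, hs y x] at h5
          omega
    exact absurd (hzmax y hyS) (not_le.2 hy)
  have hxz : f x ≤ f z := by linarith
  have hnot : ∀ y, ¬ B y → y < c ∨ f z < f y := by
    intro y hy
    by_contra h
    push Not at h
    exact hy h
  have aux : ∀ b, B b → ∀ y, f z < f y → a b y ≤ a z y :=
    fun b hb y h => (rob hb.2 h.le).2
  refine ⟨fun v => if B v then f x + f z - f v else f v, z, ?_, ?_, hcz, hzx, ?_⟩
  · apply emb_reflect hs hf B x z
    · exact fun b hb => ⟨hx b hb.1, hb.2⟩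
    · exact fun y hy => (hnot y hy).imp (hlow y) le_of_lt
    · exact ⟨hcx.le, hxz⟩
    · exact ⟨hcz, le_rfl⟩
    · intro y b hy hb
      rcases hnot y hy with h | h
      · rw [hs b y, hs x y, hmodlow y b h hb.1 hb.2, hmodlow y x h hcx.le hxz]
      · apply le_antisymm
        · exact (aux b hb y h).trans (hmodhi y h)
        · exact (rob (hx b hb.1) (hb.2.trans h.le)).2
  · intro i j hi hij
    have hBi : ¬ B i := fun h => absurd h.1 (not_le.2 hi)
    simp only [hBi, if_false]
    by_cases hj : B j
    · simp only [hj, if_true]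
      have := hlow i hi
      have := hj.2
      linarith
    · simp only [hj, if_false]
      exact hpre i j hi hij
  · intro j hj
    have hBz : B z := ⟨hcz, le_rfl⟩
    simp only [hBz, if_true]
    by_cases hBj : B j
    · simp only [hBj, if_true]
      have := hBj.2
      linarith
    · simp only [hBj, if_false]
      have := hx j hj
      linarith

lemma emb_inner {n k : ℕ} {a : Fin n → Fin n → ℕ} {d : ℕ → ℝ}
    (hA : IsRobinson n k a) (hd : IsThreshold k d) (c : Fin n) (N : ℕ) :
    ∀ (f : Fin n → ℝ) (x : Fin n), x.val ≤ N → EmbQ n k a d f →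
    (∀ i j, i < c → i < j → f i ≤ f j) → c ≤ x → (∀ j, c ≤ j → f x ≤ f j) →
    ∃ g : Fin n → ℝ, EmbQ n k a d g ∧ ∀ i j, i ≤ c → i < j → g i ≤ g j := by
  induction N with
  | zero =>
    intro f x hxN hf hpre hcx hx
    refine ⟨f, hf, fun i j hi hij => ?_⟩
    have h0 : c = x := by
      apply Fin.ext
      have : c.val ≤ x.val := hcx
      omega
    rcases hi.eq_or_lt with h | h
    · subst h; rw [h0]; exact hx j hij.le
    · exact hpre i j h hij
  | succ N ih =>
    intro f x hxN hf hpre hcx hx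
    rcases le_or_gt (f c) (f x) with h | h
    · refine ⟨f, hf, fun i j hi hij => ?_⟩
      rcases hi.eq_or_lt with h' | h'
      · subst h'; exact h.trans (hx j hij.le)
      · exact hpre i j h' hij
    · have hne : c < x := lt_of_le_of_ne hcx (by rintro rfl; exact lt_irrefl _ h)
      obtain ⟨g, z, hg, hgp, hcz, hzx, hz⟩ := emb_step hA hd hf c x hpre hne hx h
      refine ih g z ?_ hg hgp hcz hz
      have : z.val < x.val := hzx
      omega

lemma emb_sorted {n k : ℕ} {a : Fin n → Fin n → ℕ} {d : ℕ → ℝ}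
    (hA : IsRobinson n k a) (hd : IsThreshold k d) (f : Fin n → ℝ) (hf : EmbQ n k a d f) (m : ℕ) :
    m ≤ n → ∃ g : Fin n → ℝ, EmbQ n k a d g ∧ ∀ i j : Fin n, i.val < m → i < j → g i ≤ g j := by
  induction m with
  | zero => exact fun _ => ⟨f, hf, fun i j hi => absurd hi (by omega)⟩
  | succ m ih =>
    intro hm
    obtain ⟨g, hg, hp⟩ := ih (by omega)
    let c : Fin n := ⟨m, by omega⟩
    obtain ⟨x, hxm, hx⟩ := (Finset.univ.filter fun j => c ≤ j).exists_min_image g ⟨c, by simp⟩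
    simp only [Finset.mem_filter, Finset.mem_univ, true_and] at hxm hx
    obtain ⟨g', h1, h2⟩ := emb_inner hA hd c x.val g x le_rfl hg (fun i j hi hij => hp i j hi hij)
      hxm hx
    refine ⟨g', h1, fun i j hi hij => h2 i j ?_ hij⟩
    show i.val ≤ m
    omega

/-- Theorem 1 of the paper: if a Robinson matrix `A ∈ 𝒮ⁿ[k]` has a uniform
embedding with respect to some threshold vector, then there are a threshold vector `d ∈ 𝔻ᵏ`
and a strictly increasing map `Π` satisfying the strict inequality system
`a u v = t ↔ d_{t+1} < Π v − Π u < d_t` (with `d_0 = +∞`, `d_{k+1} = 0`) for all `u < v`. -/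
theorem statement0 (n k : ℕ) (hn : 1 ≤ n) (hk : 1 ≤ k) (a : Fin n → Fin n → ℕ)
    (hA : IsRobinson n k a)
    (h : ∃ (d : ℕ → ℝ) (f : Fin n → ℝ), IsThreshold k d ∧ IsUnifEmb n k a d f) :
    ∃ (d : ℕ → ℝ) (f : Fin n → ℝ), IsThreshold k d ∧ StrictMono f ∧
      SatisfiesStrict n k a d f := by
  obtain ⟨d, f₀, hd, hf₀⟩ := h
  have hf₁ : EmbQ n k a d f₀ := fun u v => (hf₀ u v _ (hA.2.2.1 u v)).1 rfl
  obtain ⟨f, hf, hmono⟩ := emb_sorted hA hd f₀ hf₁ n le_rfl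
  have hmono : ∀ u v : Fin n, u < v → f u ≤ f v := fun u v huv => hmono u v u.isLt huv
  have hδ : ∃ δ : ℝ, 0 < δ ∧ ∀ u v : Fin n, u < v → a u v = k ∨ d (a u v + 1) + δ ≤ f v - f u := by
    have hne : (Finset.univ : Finset (Fin n × Fin n)).Nonempty := ⟨(⟨0, hn⟩, ⟨0, hn⟩), by simp⟩
    let φ : Fin n × Fin n → ℝ := fun p =>
      if a p.1 p.2 = k then 1 else |f p.2 - f p.1| - d (a p.1 p.2 + 1)
    obtain ⟨p, -, hp⟩ := Finset.univ.exists_min_image φ hne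
    refine ⟨φ p, ?_, fun u v huv => ?_⟩
    · simp only [φ]
      split_ifs with h
      · exact one_pos
      · have := (hf p.1 p.2).1.resolve_left h
        linarith
    · by_cases h : a u v = k
      · exact Or.inl h
      · have := hp (u, v) (by simp)
        have h2 : φ (u, v) = f v - f u - d (a u v + 1) := by
          simp only [φ, h, if_false]
          rw [abs_of_nonneg (by linarith [hmono u v huv])]
        right; linarith
  obtain ⟨δ, hδ0, hδ⟩ := hδ
  have hn0 : (0 : ℝ) < n := by exact_mod_cast hn
  let η : ℝ := δ / (4 * n)
  have hη : 0 < η := by positivity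
  have hηn : η * n = δ / 4 := by simp only [η]; field_simp
  let g : Fin n → ℝ := fun v => f v + η * (v.val : ℝ)
  let e : ℕ → ℝ := fun t => d t + δ / 2
  have he : IsThreshold k e := by
    refine ⟨fun i h1 h2 => ?_, ?_⟩
    · have := hd.1 i h1 h2
      simp only [e]; linarith
    · have := hd.2
      simp only [e]; linarith
  have hgd : ∀ u v : Fin n, u < v → f v - f u < g v - g u ∧ g v - g u ≤ f v - f u + δ / 4 := by
    intro u v huv
    have h1 : (u.val : ℝ) < v.val := by exact_mod_cast huv
    have h2 : (v.val : ℝ) ≤ n := by exact_mod_cast v.isLt.le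
    have h3 : (0 : ℝ) ≤ u.val := by positivity
    have h4 := mul_lt_mul_of_pos_left h1 hη
    have h5 := mul_le_mul_of_nonneg_left h2 hη.le
    have h6 := mul_nonneg hη.le h3
    simp only [g]
    constructor <;> linarith
  have hg : StrictMono g := by
    intro u v huv
    have := (hgd u v huv).1
    have := hmono u v huv
    linarith
  refine ⟨e, g, he, hg, ?_⟩
  intro u v huv t ht
  have hfwd : ((if a u v = k then (0 : ℝ) else e (a u v + 1)) < g v - g u) ∧
      (a u v = 0 ∨ g v - g u < e (a u v)) := by
    have h1 := hgd u v huv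
    have h2 := hmono u v huv
    constructor
    · split_ifs with h
      · linarith
      · have := (hδ u v huv).resolve_left h
        simp only [e]; linarith
    · refine (hf u v).2.imp id fun h => ?_
      rw [abs_of_nonneg (by linarith)] at h
      simp only [e]; linarith
  constructor
  · rintro rfl
    exact hfwd
  · rintro ⟨h1, h2⟩
    obtain ⟨h3, h4⟩ := hfwd
    have hak := hA.2.2.1 u v
    rcases lt_trichotomy (a u v) t with hlt | heq | hgt
    · rw [if_neg (by omega)] at h3
      have h5 := h2.resolve_left (by omega)
      have := thr_anti he (s := a u v + 1) (t := t) (by omega) (by omega) ht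
      linarith
    · exact heq
    · rw [if_neg (by omega)] at h1
      have h5 := h4.resolve_left (by omega)
      have := thr_anti he (s := t + 1) (t := a u v) (by omega) (by omega) hak
      linarith
end

section
/- A Robinson matrix A ∈ 𝒮ⁿ[k] has a uniform embedding with respect to some threshold vector if and only if there exists d ∈ 𝔻ᵏ satisfying the path condition for A, i.e. for all u < v in [n], every (u,v)-upper-bound-path W₁ and every (u,v)-lower-bound-path W₂ satisfy β⁻(W₂)ᵀ d < β⁺(W₁)ᵀ d. -/
/-- Equivalent form of a uniform embedding. -/
def Emb (n k : ℕ) (a : Fin n → Fin n → ℕ) (d : ℕ → ℝ) (f : Fin n → ℝ) : Prop :=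
  ∀ u v : Fin n, ∀ s, 1 ≤ s → s ≤ k → (s ≤ a u v ↔ |f v - f u| ≤ d s)

lemma thr_anti_s1 {k : ℕ} {d : ℕ → ℝ} (hd : IsThreshold k d) {i j : ℕ} (hi : 1 ≤ i) (hij : i ≤ j)
    (hj : j ≤ k) : d j ≤ d i := by
  induction j, hij using Nat.le_induction with
  | base => exact le_rfl
  | succ m hm ih => exact (hd.1 m (by omega) (by omega)).le.trans (ih (by omega))

lemma thr_pos {k : ℕ} {d : ℕ → ℝ} (hd : IsThreshold k d) {i : ℕ} (hi : 1 ≤ i) (hik : i ≤ k) :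
    0 < d i := hd.2.trans_le (thr_anti_s1 hd hi hik le_rfl)

lemma emb_iff {n k : ℕ} {a : Fin n → Fin n → ℕ} {d : ℕ → ℝ} {f : Fin n → ℝ}
    (hA : IsRobinson n k a) (hd : IsThreshold k d) : IsUnifEmb n k a d f ↔ Emb n k a d f := by
  constructor
  · intro h u v s hs hsk
    have hk := hA.2.2.1 u v
    obtain ⟨h1, h2⟩ := (h u v (a u v) hk).1 rfl
    constructor
    · intro hsa
      rcases h2 with h2 | h2
      · omega
      · exact h2.trans (thr_anti_s1 hd hs hsa hk)
    · intro hD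
      by_contra hlt
      rcases h1 with h1 | h1
      · omega
      · have := thr_anti_s1 hd (i := a u v + 1) (j := s) (by omega) (by omega) hsk
        linarith
  · intro h u v t ht
    have hk := hA.2.2.1 u v
    constructor
    · intro hat
      constructor
      · by_cases htk : t = k
        · exact Or.inl htk
        · right
          by_contra hcon
          have := (h u v (t+1) (by omega) (by omega)).2 (not_lt.1 hcon)
          omega
      · by_cases ht0 : t = 0
        · exact Or.inl ht0
        · right
          exact (h u v t (by omega) ht).1 (by omega)
    · rintro ⟨h1, h2⟩
      apply le_antisymm
      · rcases h1 with h1 | h1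
        · omega
        · by_contra hcon
          by_cases htk : t = k
          · omega
          have := (h u v (t+1) (by omega) (by omega)).1 (by omega)
          linarith
      · rcases h2 with h2 | h2
        · omega
        · by_cases ht0 : t = 0
          · omega
          · exact (h u v t (by omega) ht).2 h2

lemma rob {n k : ℕ} {a : Fin n → Fin n → ℕ} (hA : IsRobinson n k a) {u p q v : Fin n}
    (h1 : u ≤ p) (h2 : p ≤ q) (h3 : q ≤ v) : a u v ≤ a p q := by
  obtain ⟨hs, hdg, hle, hR⟩ := hA
  rcases h2.eq_or_lt with rfl | h2
  · rw [hdg]; exact hle _ _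
  have e1 : a u v ≤ a p v := by
    rcases h1.eq_or_lt with rfl | h1
    · exact le_rfl
    · exact (hR u p v h1 (h2.trans_le h3)).2
  have e2 : a p v ≤ a p q := by
    rcases h3.eq_or_lt with rfl | h3
    · exact le_rfl
    · exact (hR p q v h2 h3).1
  exact e1.trans e2

/-- Reflecting a homogeneous, separated set of vertices. -/
lemma emb_reflect_s1 {n k : ℕ} {a : Fin n → Fin n → ℕ} {d : ℕ → ℝ} {f : Fin n → ℝ}
    (hA : IsRobinson n k a) (hf : Emb n k a d f) (M : Fin n → Prop) (hM : ∃ x, M x)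
    (hom : ∀ x y z, ¬ M x → M y → M z → a x y = a x z)
    (sep : ∀ x, ¬ M x → (∀ y, M y → f x < f y) ∨ (∀ y, M y → f y < f x)) :
    ∃ f', Emb n k a d f' ∧ (∀ x y, M x → M y → (f' x < f' y ↔ f y < f x)) ∧
      (∀ x y, ¬ (M x ∧ M y) → (f' x < f' y ↔ f x < f y)) := by
  classical
  obtain ⟨x0, hx0⟩ := hM
  obtain ⟨p, hp, hpm⟩ := Finset.exists_min_image (Finset.univ.filter M) f ⟨x0, by simpa using hx0⟩
  obtain ⟨q, hq, hqm⟩ := Finset.exists_max_image (Finset.univ.filter M) f ⟨x0, by simpa using hx0⟩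
  simp only [Finset.mem_filter, Finset.mem_univ, true_and] at hp hpm hq hqm
  have key : ∀ u v, ¬ M u → M v → ∀ s, 1 ≤ s → s ≤ k →
      (s ≤ a u v ↔ |(f p + f q - f v) - f u| ≤ d s) := by
    intro u v hu hv s hs hsk
    have ep := hf u p s hs hsk
    have eq := hf u q s hs hsk
    rw [hom u p v hu hp hv] at ep
    rw [hom u q v hu hq hv] at eq
    have b1 := hpm v hv
    have b2 := hqm v hv
    rcases sep u hu with h | h
    · have := h p hp
      have := h q hq
      have := h v hv
      constructor
      · intro hh
        have := eq.1 hh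
        rw [abs_le] at this ⊢
        constructor <;> linarith [this.1, this.2]
      · intro hh
        apply ep.2
        rw [abs_le] at hh ⊢
        constructor <;> linarith [hh.1, hh.2]
    · have := h p hp
      have := h q hq
      have := h v hv
      constructor
      · intro hh
        have := ep.1 hh
        rw [abs_le] at this ⊢
        constructor <;> linarith [this.1, this.2]
      · intro hh
        apply eq.2
        rw [abs_le] at hh ⊢
        constructor <;> linarith [hh.1, hh.2]
  refine ⟨fun x => if M x then f p + f q - f x else f x, ?_, ?_, ?_⟩
  · intro u v s hs hsk
    by_cases hu : M u <;> by_cases hv : M v <;> simp only [hu, hv, if_true, if_false]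
    · rw [hf u v s hs hsk, abs_sub_comm (f v) (f u)]
      ring_nf
    · rw [hA.1 u v, abs_sub_comm, key v u hv hu s hs hsk]
    · exact key u v hu hv s hs hsk
    · exact hf u v s hs hsk
  · intro x y hx hy
    simp only [hx, hy, if_true]
    constructor <;> intro h <;> linarith
  · intro x y hxy
    by_cases hu : M x <;> by_cases hv : M y <;> simp only [hu, hv, if_true, if_false]
    · exact absurd ⟨hu, hv⟩ hxy
    · rcases sep y hv with h | h <;> have h1 := h p hp <;> have h2 := h q hq <;>
        have h3 := h x hu <;> have b1 := hpm x hu <;> have b2 := hqm x hu <;> constructor <;>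
        intro h <;> linarith
    · rcases sep x hu with h | h <;> have h1 := h p hp <;> have h2 := h q hq <;>
        have h3 := h y hv <;> have b1 := hpm y hv <;> have b2 := hqm y hv <;> constructor <;>
        intro h <;> linarith

/-- Same component of the level-`s` graph. -/
def Conn {n : ℕ} (a : Fin n → Fin n → ℕ) (s : ℕ) (u v : Fin n) : Prop :=
  ∀ i j : Fin n, i.val + 1 = j.val →
    ((u.val ≤ i.val ∧ j.val ≤ v.val) ∨ (v.val ≤ i.val ∧ j.val ≤ u.val)) → s ≤ a i j

lemma conn_refl {n : ℕ} (a : Fin n → Fin n → ℕ) (s : ℕ) (u : Fin n) : Conn a s u u := by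
  intro i j h1 h2; omega

lemma conn_symm {n : ℕ} {a : Fin n → Fin n → ℕ} {s : ℕ} {u v : Fin n} (h : Conn a s u v) :
    Conn a s v u := fun i j h1 h2 => h i j h1 h2.symm

lemma conn_trans {n : ℕ} {a : Fin n → Fin n → ℕ} {s : ℕ} {u v w : Fin n} (h : Conn a s u v)
    (h' : Conn a s v w) : Conn a s u w := by
  intro i j h1 h2
  by_cases hc : (u.val ≤ i.val ∧ j.val ≤ v.val) ∨ (v.val ≤ i.val ∧ j.val ≤ u.val)
  · exact h i j h1 hc
  · exact h' i j h1 (by omega)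

/-- everything between two connected vertices is connected to them -/
lemma conn_mid {n : ℕ} {a : Fin n → Fin n → ℕ} {s : ℕ} {u v p : Fin n} (h : Conn a s u v)
    (h1 : u ≤ p) (h2 : p ≤ v) : Conn a s u p := by
  intro i j e1 e2
  rw [Fin.le_def] at h1 h2
  exact h i j e1 (by omega)

lemma not_conn_lt {n k : ℕ} {a : Fin n → Fin n → ℕ} (hA : IsRobinson n k a) {s : ℕ}
    {u v : Fin n} (h : ¬ Conn a s u v) : a u v < s := by
  unfold Conn at h
  push Not at h
  obtain ⟨i, j, h1, h2, h3⟩ := h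
  rcases h2 with h2 | h2
  · have := rob hA (u := u) (p := i) (q := j) (v := v) (Fin.le_def.2 h2.1)
      (Fin.le_def.2 (by omega)) (Fin.le_def.2 h2.2)
    omega
  · have := rob hA (u := v) (p := i) (q := j) (v := u) (Fin.le_def.2 h2.1)
      (Fin.le_def.2 (by omega)) (Fin.le_def.2 h2.2)
    rw [hA.1 v u] at this
    omega

lemma interval_induct {n : ℕ} (Q : Fin n → Prop) {y z : Fin n} (hyz : y ≤ z)
    (h : ∀ i j : Fin n, i.val + 1 = j.val → y ≤ i → j ≤ z → (Q i ↔ Q j)) : Q y ↔ Q z := by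
  have : ∀ m : ℕ, ∀ w : Fin n, w.val = y.val + m → w ≤ z → (Q y ↔ Q w) := by
    intro m
    induction m with
    | zero => intro w hw _; rw [show w = y from Fin.ext hw]
    | succ m ih =>
      intro w hw hwz
      have hlt : y.val + m < n := by have := w.isLt; omega
      have hz : (⟨y.val + m, hlt⟩ : Fin n) ≤ z := by
        rw [Fin.le_def] at hwz ⊢
        simp only
        omega
      rw [ih ⟨y.val + m, hlt⟩ rfl hz]
      exact h _ w (by simp only; omega) (by rw [Fin.le_def]; simp) hwz
  rw [Fin.le_def] at hyz
  exact this (z.val - y.val) z (by omega) le_rfl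

/-- A vertex outside of a component lies on one side of it. -/
lemma sign_lt {n k : ℕ} {a : Fin n → Fin n → ℕ} {d : ℕ → ℝ} {f : Fin n → ℝ}
    (hA : IsRobinson n k a) (hf : Emb n k a d f) {s : ℕ} (hs : 1 ≤ s) (hsk : s ≤ k)
    {x y z : Fin n} (hxy : ¬ Conn a s x y) (hyz : Conn a s y z) : f x < f y ↔ f x < f z := by
  have step : ∀ i j : Fin n, Conn a s y i → Conn a s y j → s ≤ a i j →
      (f x < f i ↔ f x < f j) := by
    intro i j hi hj hij
    have e1 := not_conn_lt hA (fun h => hxy (conn_trans h (conn_symm hi)))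
    have e2 := not_conn_lt hA (fun h => hxy (conn_trans h (conn_symm hj)))
    have g1 := (hf x i s hs hsk).not.1 (by omega)
    have g2 := (hf x j s hs hsk).not.1 (by omega)
    have g3 := (hf i j s hs hsk).1 hij
    rw [not_le, lt_abs] at g1 g2
    rw [abs_le] at g3
    have g0 : 0 ≤ d s := by linarith [g3.1, g3.2]
    constructor
    · intro h
      rcases g1 with g1 | g1
      · rcases g2 with g2 | g2 <;> linarith [g3.1, g3.2]
      · linarith
    · intro h
      rcases g2 with g2 | g2
      · rcases g1 with g1 | g1 <;> linarith [g3.1, g3.2]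
      · linarith
  rcases le_total y z with h | h
  · refine interval_induct (fun i => f x < f i) h ?_
    intro i j hij hi hj
    have hij' : i ≤ j := Fin.le_def.2 (by omega)
    exact step i j (conn_mid hyz hi (hij'.trans hj)) (conn_mid hyz (hi.trans hij') hj)
      (hyz i j hij (Or.inl ⟨hi, hj⟩))
  · symm
    refine interval_induct (fun i => f x < f i) h ?_
    intro i j hij hi hj
    have hij' : i ≤ j := Fin.le_def.2 (by omega)
    exact step i j
      (conn_trans hyz (conn_mid (conn_symm hyz) hi (hij'.trans hj)))
      (conn_trans hyz (conn_mid (conn_symm hyz) (hi.trans hij') hj))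
      (hyz i j hij (Or.inr ⟨hi, hj⟩))

lemma nadj_ne {n k : ℕ} {a : Fin n → Fin n → ℕ} {d : ℕ → ℝ} {f : Fin n → ℝ}
    (hd : IsThreshold k d) (hf : Emb n k a d f) {s : ℕ} (hs : 1 ≤ s) (hsk : s ≤ k)
    {x y : Fin n} (h : a x y < s) : f x ≠ f y := by
  intro he
  have g := (hf x y s hs hsk).not.1 (by omega)
  rw [he, sub_self, abs_zero] at g
  exact g (thr_pos hd hs hsk).le

lemma sign_gt {n k : ℕ} {a : Fin n → Fin n → ℕ} {d : ℕ → ℝ} {f : Fin n → ℝ}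
    (hA : IsRobinson n k a) (hd : IsThreshold k d)
    (hf : Emb n k a d f) {s : ℕ} (hs : 1 ≤ s) (hsk : s ≤ k)
    {x y z : Fin n} (hxy : ¬ Conn a s x y) (hyz : Conn a s y z) : f y < f x ↔ f z < f x := by
  have h := sign_lt hA hf hs hsk hxy hyz
  have n1 := nadj_ne hd hf hs hsk (not_conn_lt hA hxy)
  have n2 := nadj_ne hd hf hs hsk
    (not_conn_lt hA (fun h' => hxy (conn_trans h' (conn_symm hyz))))
  constructor
  · intro h1
    exact lt_of_le_of_ne (not_lt.1 (h.not.1 (not_lt.2 h1.le))) n2.symm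
  · intro h1
    exact lt_of_le_of_ne (not_lt.1 (h.not.2 (not_lt.2 h1.le))) n1.symm

/-- If `i j` are close but both far from `q`, they are on the same side of `q`. -/
lemma close_side {n k : ℕ} {a : Fin n → Fin n → ℕ} {d : ℕ → ℝ} {f : Fin n → ℝ}
    (hf : Emb n k a d f) {s : ℕ} (hs : 1 ≤ s) (hsk : s ≤ k)
    {i j q : Fin n} (hij : s ≤ a i j) (hi : a i q < s) :
    (f i < f q → f j < f q) ∧ (f q < f i → f q < f j) := by
  have g1 := (hf i q s hs hsk).not.1 (by omega)
  have g3 := (hf i j s hs hsk).1 hij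
  rw [not_le, lt_abs] at g1
  rw [abs_le] at g3
  constructor <;> intro h <;> rcases g1 with g1 | g1 <;> linarith [g3.1, g3.2]

lemma roberts_left {n k : ℕ} {a : Fin n → Fin n → ℕ} {d : ℕ → ℝ} {f : Fin n → ℝ}
    (hA : IsRobinson n k a) (hf : Emb n k a d f) {s : ℕ} (hs : 1 ≤ s) (hsk : s ≤ k)
    {p' p q : Fin n} (h1 : p' ≤ p) (h2 : p < q) (h3 : a p q < s) (hc : Conn a s p' p) :
    f p' < f q ↔ f p < f q := by
  refine interval_induct (fun i => f i < f q) h1 ?_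
  intro i j hij hi hj
  have hij' : i ≤ j := Fin.le_def.2 (by omega)
  have e := hc i j hij (Or.inl ⟨hi, hj⟩)
  have b1 := rob hA (hij'.trans hj) h2.le (le_refl q)
  have b2 := rob hA hj h2.le (le_refl q)
  exact ⟨(close_side hf hs hsk e (by omega)).1,
    (close_side hf hs hsk (by rw [hA.1]; exact e) (by omega)).1⟩

lemma roberts_right {n k : ℕ} {a : Fin n → Fin n → ℕ} {d : ℕ → ℝ} {f : Fin n → ℝ}
    (hA : IsRobinson n k a) (hf : Emb n k a d f) {s : ℕ} (hs : 1 ≤ s) (hsk : s ≤ k)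
    {p q q' : Fin n} (h1 : q ≤ q') (h2 : p < q) (h3 : a p q < s) (hc : Conn a s q q') :
    f p < f q ↔ f p < f q' := by
  refine interval_induct (fun i => f p < f i) h1 ?_
  intro i j hij hi hj
  have hij' : i ≤ j := Fin.le_def.2 (by omega)
  have e := hc i j hij (Or.inl ⟨hi, hj⟩)
  have b1 := rob hA (le_refl p) h2.le hi
  have b2 := rob hA (le_refl p) h2.le (hi.trans hij')
  rw [hA.1 p i] at b1
  rw [hA.1 p j] at b2
  exact ⟨(close_side hf hs hsk e (by omega)).2,
    (close_side hf hs hsk (by rw [hA.1]; exact e) (by omega)).2⟩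

/-- widening a non-adjacent pair -/
lemma roberts_widen {n k : ℕ} {a : Fin n → Fin n → ℕ} {d : ℕ → ℝ} {f : Fin n → ℝ}
    (hA : IsRobinson n k a) (hf : Emb n k a d f) {s : ℕ} (hs : 1 ≤ s) (hsk : s ≤ k)
    {p' p q q' : Fin n} (h1 : p' ≤ p) (h2 : p < q) (h4 : q ≤ q') (h3 : a p q < s)
    (hc : Conn a s p' q') : f p < f q ↔ f p' < f q' := by
  have c1 : Conn a s p' p := conn_mid hc h1 (h2.le.trans h4)
  have c2 : Conn a s p' q := conn_mid hc (h1.trans h2.le) h4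
  rw [← roberts_left hA hf hs hsk h1 h2 h3 c1]
  have := rob hA h1 h2.le (le_refl q)
  exact roberts_right hA hf hs hsk h4 (h1.trans_lt h2) (by omega) (conn_trans (conn_symm c2) hc)

lemma roberts_pair {n k : ℕ} {a : Fin n → Fin n → ℕ} {d : ℕ → ℝ} {f : Fin n → ℝ}
    (hA : IsRobinson n k a) (hf : Emb n k a d f) {s : ℕ} (hs : 1 ≤ s) (hsk : s ≤ k)
    {w y z y' z' : Fin n} (h1 : y < z) (h2 : y' < z') (e1 : a y z < s) (e2 : a y' z' < s)
    (c1 : Conn a s w y) (c2 : Conn a s w z) (c3 : Conn a s w y') (c4 : Conn a s w z') :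
    f y < f z ↔ f y' < f z' := by
  have cm : Conn a s w (min y y') := by rcases min_choice y y' with h | h <;> rw [h] <;> assumption
  have cM : Conn a s w (max z z') := by rcases max_choice z z' with h | h <;> rw [h] <;> assumption
  have c := conn_trans (conn_symm cm) cM
  rw [roberts_widen hA hf hs hsk (min_le_left _ _) h1 (le_max_left _ _) e1 c,
    roberts_widen hA hf hs hsk (min_le_right _ _) h2 (le_max_right _ _) e2 c]

/-- non-twins at level `s` are governed by a non-adjacent pair -/
lemma nontwin_pair {n k : ℕ} {a : Fin n → Fin n → ℕ} {d : ℕ → ℝ} {f : Fin n → ℝ}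
    (hA : IsRobinson n k a) (hf : Emb n k a d f) {s : ℕ} (hs : 1 ≤ s) (hsk : s ≤ k)
    {u v x : Fin n} (huv : u < v) (hc : Conn a s u v) (hx : ¬ (s ≤ a x u ↔ s ≤ a x v)) :
    ∃ y z, y < z ∧ a y z < s ∧ Conn a s u y ∧ Conn a s u z ∧ (f y < f z → f u < f v) ∧
      (f z < f y → f v < f u) := by
  by_cases h1 : s ≤ a x u
  · have h2 : a x v < s := by by_contra h; exact hx ⟨fun _ => not_lt.1 h, fun _ => h1⟩
    have hxv : x < v := by
      by_contra h
      have := rob hA huv.le (not_lt.1 h) (le_refl x)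
      rw [hA.1 v x] at this
      have := rob hA (le_refl u) huv.le (not_lt.1 h)
      have := rob hA (le_refl u) (huv.le.trans (not_lt.1 h)) (le_refl x)
      have := hA.1 u x
      omega
    refine ⟨x, v, hxv, h2, ?_, hc, ?_⟩
    · by_contra h
      have := not_conn_lt hA h
      rw [hA.1] at this
      omega
    · exact close_side hf hs hsk h1 h2
  · have h2 : s ≤ a x v := by by_contra h; exact hx ⟨fun h' => absurd h' h1, fun h' => absurd h' h⟩
    have hxu : u < x := by
      by_contra h
      have := rob hA (le_refl x) (not_lt.1 h) huv.le
      omega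
    refine ⟨u, x, hxu, by rw [hA.1]; omega, conn_refl _ _ _, ?_, ?_⟩
    · by_contra h
      have := not_conn_lt hA (s := s) (u := x) (v := v)
        (fun h' => h (conn_trans hc (conn_symm h')))
      omega
    · have := close_side hf hs hsk h2 (q := u) (by omega)
      exact ⟨this.2, this.1⟩

/-- twins with respect to the levels up to `t` -/
def Tw {n : ℕ} (a : Fin n → Fin n → ℕ) (t : ℕ) (u v : Fin n) : Prop :=
  ∀ x, min (a x u) t = min (a x v) t

lemma tw_symm {n : ℕ} {a : Fin n → Fin n → ℕ} {t : ℕ} {u v : Fin n} (h : Tw a t u v) :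
    Tw a t v u := fun x => (h x).symm

lemma tw_trans {n : ℕ} {a : Fin n → Fin n → ℕ} {t : ℕ} {u v w : Fin n} (h : Tw a t u v)
    (h' : Tw a t v w) : Tw a t u w := fun x => (h x).trans (h' x)

lemma tw_mid {n k : ℕ} {a : Fin n → Fin n → ℕ} (hA : IsRobinson n k a) {t : ℕ} (ht : t ≤ k)
    {l p r : Fin n} (h : Tw a t l r) (h1 : l ≤ p) (h2 : p ≤ r) : Tw a t l p := by
  intro x
  have hlr : t ≤ a l r := by
    have := h l
    rw [hA.2.1 l] at this
    omega
  have hx := h x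
  rcases le_total x l with hxl | hxl
  · have := rob hA (le_refl x) (hxl.trans h1) h2
    have := rob hA (le_refl x) hxl h1
    omega
  rcases le_total r x with hxr | hxr
  · have b1 := rob hA h1 (h2.trans hxr) (le_refl x)
    have b2 := rob hA h2 hxr (le_refl x)
    rw [hA.1 l x, hA.1 p x] at b1
    rw [hA.1 p x, hA.1 r x] at b2
    omega
  · have b1 := rob hA (le_refl l) hxl hxr
    rw [hA.1 l x] at b1
    have b2 : a l r ≤ a x p := by
      rcases le_total x p with h | h
      · exact rob hA hxl h h2
      · rw [hA.1 x p]; exact rob hA h1 h hxr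
    omega

lemma minimize {n : ℕ} (P : (Fin n → ℝ) → Prop) (C : Fin n → Fin n → Prop)
    (step : ∀ f, P f → (∃ u v, u < v ∧ C u v ∧ ¬ f u < f v) → ∃ f', P f' ∧
      (∀ u v, u < v → C u v → f u < f v → f' u < f' v) ∧
      ∃ u v, u < v ∧ C u v ∧ ¬ f u < f v ∧ f' u < f' v) (h : ∃ f, P f) :
    ∃ f, P f ∧ ∀ u v, u < v → C u v → f u < f v := by
  classical
  let N : (Fin n → ℝ) → Finset (Fin n × Fin n) := fun f =>
    Finset.univ.filter (fun p => p.1 < p.2 ∧ C p.1 p.2 ∧ ¬ f p.1 < f p.2)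
  obtain ⟨f0, hf0⟩ := h
  have : ∀ m : ℕ, ∀ f, P f → (N f).card = m → ∃ f, P f ∧ ∀ u v, u < v → C u v → f u < f v := by
    intro m
    induction m using Nat.strong_induction_on with
    | _ m ih =>
      intro f hf hm
      by_cases hb : ∃ u v, u < v ∧ C u v ∧ ¬ f u < f v
      · obtain ⟨f', hP, hmono, u, v, huv, hC, hn, hy⟩ := step f hf hb
        refine ih (N f').card ?_ f' hP rfl
        rw [← hm]
        apply Finset.card_lt_card
        rw [Finset.ssubset_iff_of_subset]
        · refine ⟨(u, v), ?_, ?_⟩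
          · simp only [N, Finset.mem_filter, Finset.mem_univ, true_and]
            exact ⟨huv, hC, hn⟩
          · simp only [N, Finset.mem_filter, Finset.mem_univ, true_and]
            exact fun h => h.2.2 hy
        · intro p hp
          simp only [N, Finset.mem_filter, Finset.mem_univ, true_and] at hp ⊢
          exact ⟨hp.1, hp.2.1, fun h => hp.2.2 (hmono _ _ hp.1 hp.2.1 h)⟩
      · refine ⟨f, hf, fun u v huv hC => ?_⟩
        by_contra h
        exact hb ⟨u, v, huv, hC, h⟩
  exact this _ f0 hf0 rfl

lemma phase_one {n k : ℕ} {a : Fin n → Fin n → ℕ} {d : ℕ → ℝ}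
    (hA : IsRobinson n k a) (hd : IsThreshold k d) {t : ℕ} (ht : t + 1 ≤ k)
    (h : ∃ f, Emb n k a d f ∧ ∀ u v, u < v → ¬ Tw a t u v → f u < f v) :
    ∃ f, (Emb n k a d f ∧ ∀ u v, u < v → ¬ Tw a t u v → f u < f v) ∧
      ∀ u v, u < v → ¬ Conn a (t + 1) u v → f u < f v := by
  classical
  refine minimize _ _ ?_ h
  rintro f ⟨hf, hI⟩ ⟨u0, v0, h0⟩
  have h1t : 1 ≤ t + 1 := by omega
  obtain ⟨⟨u, v⟩, hm, hmin⟩ := Finset.exists_min_image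
    (Finset.univ.filter (fun p : Fin n × Fin n =>
      p.1 < p.2 ∧ ¬ Conn a (t + 1) p.1 p.2 ∧ ¬ f p.1 < f p.2)) (fun p => f p.1 - f p.2)
    ⟨(u0, v0), by simpa using h0⟩
  simp only [Finset.mem_filter, Finset.mem_univ, true_and, Prod.forall] at hm hmin
  obtain ⟨huv, hC, hb⟩ := hm
  have hvu : f v < f u := lt_of_le_of_ne (not_lt.1 hb)
    (nadj_ne hd hf h1t ht (not_conn_lt hA hC)).symm
  have hC' : ¬ Conn a (t + 1) v u := fun h => hC (conn_symm h)
  have Hlt : ∀ p q, Conn a (t + 1) u p → Conn a (t + 1) v q → f q < f p := by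
    intro p q hp hq
    have e1 : f v < f p := (sign_lt hA hf h1t ht hC' hp).1 hvu
    exact (sign_gt hA hd hf h1t ht (x := p) (y := v)
      (fun h => hC (conn_trans hp h)) hq).1 e1
  have Hσ : ∀ p q, Conn a (t + 1) u p → Conn a (t + 1) v q → p < q := by
    intro p q hp hq
    have e1 : p < v := by
      by_contra h
      exact hC (conn_mid hp huv.le (not_lt.1 h))
    by_contra h
    exact hC (conn_trans hp (conn_symm (conn_trans hq (conn_mid (conn_symm (conn_trans hq (conn_refl _ _ _))) (not_lt.1 h) e1.le))))
  have hTuv : Tw a t u v := by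
    by_contra h
    exact hb (hI u v huv h)
  have hTu : ∀ p, Conn a (t + 1) u p → Tw a t p u := by
    intro p hp
    by_contra h
    have h' : ¬ Tw a t p v := fun h' => h (tw_trans h' (tw_symm hTuv))
    have := hI p v (Hσ p v hp (conn_refl _ _ _)) h'
    exact lt_asymm this (Hlt p v hp (conn_refl _ _ _))
  have hTv : ∀ q, Conn a (t + 1) v q → Tw a t q u := by
    intro p hp
    by_contra h
    have h' : ¬ Tw a t u p := fun h' => h (tw_symm h')
    have := hI u p (Hσ u p (conn_refl _ _ _) hp) h'
    exact lt_asymm this (Hlt u p (conn_refl _ _ _) hp)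
  have hTM : ∀ p, (Conn a (t + 1) u p ∨ Conn a (t + 1) v p) → Tw a t p u := by
    rintro p (hp | hp)
    · exact hTu p hp
    · exact hTv p hp
  have hTMM : ∀ p q, (Conn a (t + 1) u p ∨ Conn a (t + 1) v p) →
      (Conn a (t + 1) u q ∨ Conn a (t + 1) v q) → Tw a t p q :=
    fun p q hp hq => tw_trans (hTM p hp) (tw_symm (hTM q hq))
  have hout : ∀ x p, ¬ (Conn a (t + 1) u x ∨ Conn a (t + 1) v x) →
      (Conn a (t + 1) u p ∨ Conn a (t + 1) v p) → ¬ Conn a (t + 1) x p := by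
    rintro x p hx (hp | hp) h
    · exact hx (Or.inl (conn_trans hp (conn_symm h)))
    · exact hx (Or.inr (conn_trans hp (conn_symm h)))
  obtain ⟨f', hf', hin, hoth⟩ := emb_reflect_s1 hA hf
    (fun x => Conn a (t + 1) u x ∨ Conn a (t + 1) v x) ⟨u, Or.inl (conn_refl _ _ _)⟩
    (by
      intro x y z hx hy hz
      have e1 := not_conn_lt hA (hout x y hx hy)
      have e2 := not_conn_lt hA (hout x z hx hz)
      have := hTMM y z hy hz x
      omega)
    (by
      intro x hx
      have nu : ¬ Conn a (t + 1) x u := hout x u hx (Or.inl (conn_refl _ _ _))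
      have nv : ¬ Conn a (t + 1) x v := hout x v hx (Or.inr (conn_refl _ _ _))
      have neu := nadj_ne hd hf h1t ht (not_conn_lt hA nu)
      have nev := nadj_ne hd hf h1t ht (not_conn_lt hA nv)
      rcases lt_or_gt_of_ne nev with h1 | h1
      · left
        rintro y (hy | hy)
        · exact (sign_lt hA hf h1t ht nu hy).1 (h1.trans hvu)
        · exact (sign_lt hA hf h1t ht nv hy).1 h1
      rcases lt_or_gt_of_ne neu with h2 | h2
      · exfalso
        rcases lt_trichotomy u x with h3 | h3 | h3
        · have := hmin u x ⟨h3, fun h => nu (conn_symm h), not_lt.2 h2.le⟩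
          linarith
        · exact neu (by rw [h3])
        · have := hmin x v ⟨h3.trans huv, nv, not_lt.2 h1.le⟩
          linarith
      · right
        rintro y (hy | hy)
        · exact (sign_gt hA hd hf h1t ht nu hy).1 h2
        · exact (sign_gt hA hd hf h1t ht nv hy).1 h1)
  refine ⟨f', ⟨hf', ?_⟩, ?_, u, v, huv, hC, hb, ?_⟩
  · intro x y hxy hT
    rw [hoth x y (fun h => hT (hTMM x y h.1 h.2))]
    exact hI x y hxy hT
  · intro x y hxy hc hlt
    by_cases hM : (Conn a (t + 1) u x ∨ Conn a (t + 1) v x) ∧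
      (Conn a (t + 1) u y ∨ Conn a (t + 1) v y)
    · exfalso
      rcases hM with ⟨h1 | h1, h2 | h2⟩
      · exact hc (conn_trans (conn_symm h1) h2)
      · exact lt_asymm hlt (Hlt x y h1 h2)
      · exact lt_asymm hxy (Hσ y x h2 h1)
      · exact hc (conn_trans (conn_symm h1) h2)
    · exact (hoth x y hM).2 hlt
  · exact (hin u v (Or.inl (conn_refl _ _ _)) (Or.inr (conn_refl _ _ _))).2 hvu

lemma phase_two {n k : ℕ} {a : Fin n → Fin n → ℕ} {d : ℕ → ℝ}
    (hA : IsRobinson n k a) (hd : IsThreshold k d) {t : ℕ} (ht : t + 1 ≤ k)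
    (h : ∃ f, (Emb n k a d f ∧ ∀ u v, u < v → ¬ Tw a t u v → f u < f v) ∧
      ∀ u v, u < v → ¬ Conn a (t + 1) u v → f u < f v) :
    ∃ f, ((Emb n k a d f ∧ ∀ u v, u < v → ¬ Tw a t u v → f u < f v) ∧
      ∀ u v, u < v → ¬ Conn a (t + 1) u v → f u < f v) ∧
      ∀ u v, u < v → ¬ Tw a (t + 1) u v → f u < f v := by
  classical
  refine minimize _ _ ?_ h
  rintro f ⟨⟨hf, hI⟩, hJ⟩ ⟨u, v, huv, hnT, hb⟩
  have h1t : 1 ≤ t + 1 := by omega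
  have hC : Conn a (t + 1) u v := by
    by_contra h
    exact hb (hJ u v huv h)
  have ex : ∀ p q, Tw a t p q → ¬ Tw a (t + 1) p q →
      ∃ x, ¬ (t + 1 ≤ a x p ↔ t + 1 ≤ a x q) := by
    intro p q h1 h2
    unfold Tw at h2
    push Not at h2
    obtain ⟨x, hx⟩ := h2
    have := h1 x
    exact ⟨x, by omega⟩
  have hTuv : Tw a t u v := by
    by_contra h
    exact hb (hI u v huv h)
  obtain ⟨x, hx⟩ := ex u v hTuv hnT
  obtain ⟨y, z, hyz, ayz, cy, cz, hlt, -⟩ := nontwin_pair hA hf h1t ht huv hC hx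
  have hnyz : ¬ f y < f z := fun h => hb (hlt h)
  have hTM : ∀ p, Conn a (t + 1) u p → Tw a t p y := by
    intro p hp
    have cm : Conn a (t + 1) u (min p y) := by
      rcases min_choice p y with h | h <;> rw [h] <;> assumption
    have cM : Conn a (t + 1) u (max p z) := by
      rcases max_choice p z with h | h <;> rw [h] <;> assumption
    have hw := roberts_widen hA hf h1t ht (min_le_right p y) hyz (le_max_right p z) ayz
      (conn_trans (conn_symm cm) cM)
    have hl : min p y < max p z := ((min_le_right p y).trans_lt hyz).trans_le (le_max_right p z)
    have hT : Tw a t (min p y) (max p z) := by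
      by_contra h
      exact hnyz (hw.2 (hI _ _ hl h))
    exact tw_trans (tw_symm (tw_mid hA (by omega) hT (min_le_left _ _) (le_max_left _ _)))
      (tw_mid hA (by omega) hT (min_le_right _ _) (hyz.le.trans (le_max_right _ _)))
  have hTMM : ∀ p q, Conn a (t + 1) u p → Conn a (t + 1) u q → Tw a t p q :=
    fun p q hp hq => tw_trans (hTM p hp) (tw_symm (hTM q hq))
  have anti : ∀ p q, Conn a (t + 1) u p → Conn a (t + 1) u q → p < q → ¬ Tw a (t + 1) p q →
      f q < f p := by
    intro p q hp hq hpq hn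
    obtain ⟨x, hx⟩ := ex p q (hTMM p q hp hq) hn
    obtain ⟨y', z', hyz', ayz', cy', cz', -, hgt⟩ := nontwin_pair hA hf h1t ht hpq
      (conn_trans (conn_symm hp) hq) hx
    apply hgt
    have hr := roberts_pair hA hf h1t ht hyz hyz' ayz ayz' cy cz (conn_trans hp cy')
      (conn_trans hp cz')
    exact lt_of_le_of_ne (not_lt.1 (hr.not.1 hnyz)) (nadj_ne hd hf h1t ht ayz').symm
  have hout : ∀ x p, ¬ Conn a (t + 1) u x → Conn a (t + 1) u p → ¬ Conn a (t + 1) x p :=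
    fun x p hx hp h => hx (conn_trans hp (conn_symm h))
  obtain ⟨f', hf', hin, hoth⟩ := emb_reflect_s1 hA hf
    (fun x => Conn a (t + 1) u x) ⟨u, conn_refl _ _ _⟩
    (by
      intro x y z hx hy hz
      have e1 := not_conn_lt hA (hout x y hx hy)
      have e2 := not_conn_lt hA (hout x z hx hz)
      have := hTMM y z hy hz x
      omega)
    (by
      intro x hx
      have nu : ¬ Conn a (t + 1) x u := hout x u hx (conn_refl _ _ _)
      have neu := nadj_ne hd hf h1t ht (not_conn_lt hA nu)
      rcases lt_or_gt_of_ne neu with h2 | h2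
      · exact Or.inl fun y hy => (sign_lt hA hf h1t ht nu hy).1 h2
      · exact Or.inr fun y hy => (sign_gt hA hd hf h1t ht nu hy).1 h2)
  refine ⟨f', ⟨⟨hf', ?_⟩, ?_⟩, ?_, u, v, huv, hnT, hb, ?_⟩
  · intro x y hxy hT
    rw [hoth x y (fun h => hT (hTMM x y h.1 h.2))]
    exact hI x y hxy hT
  · intro x y hxy hT
    rw [hoth x y (fun h => hT (conn_trans (conn_symm h.1) h.2))]
    exact hJ x y hxy hT
  · intro x y hxy hT hl
    by_cases hM : Conn a (t + 1) u x ∧ Conn a (t + 1) u y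
    · exact absurd hl (lt_asymm (anti x y hM.1 hM.2 hxy hT))
    · exact (hoth x y hM).2 hl
  · exact (hin u v (conn_refl _ _ _) hC).2 (anti u v (conn_refl _ _ _) hC huv hnT)

lemma levels {n k : ℕ} {a : Fin n → Fin n → ℕ} {d : ℕ → ℝ}
    (hA : IsRobinson n k a) (hd : IsThreshold k d) (h : ∃ f, Emb n k a d f) (t : ℕ) (ht : t ≤ k) :
    ∃ f, Emb n k a d f ∧ ∀ u v, u < v → ¬ Tw a t u v → f u < f v := by
  induction t with
  | zero =>
    obtain ⟨f, hf⟩ := h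
    exact ⟨f, hf, fun u v _ hn => absurd (fun x => by simp) hn⟩
  | succ t ih =>
    obtain ⟨f, ⟨⟨hf, _⟩, _⟩, h2⟩ := phase_two hA hd ht (phase_one hA hd ht (ih (by omega)))
    exact ⟨f, hf, h2⟩

/-- An embedding can be made monotone with respect to the given Robinson ordering. -/
lemma exists_mono {n k : ℕ} {a : Fin n → Fin n → ℕ} {d : ℕ → ℝ}
    (hA : IsRobinson n k a) (hd : IsThreshold k d) (h : ∃ f, Emb n k a d f) :
    ∃ g, Emb n k a d g ∧ ∀ u v, u ≤ v → g u ≤ g v := by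
  obtain ⟨f, hf, hI⟩ := levels hA hd h k le_rfl
  have hm : ∀ u : Fin n, ∃ w, w ≤ u ∧ ∀ x, x ≤ u → f x ≤ f w := by
    intro u
    obtain ⟨w, hw, hw'⟩ := Finset.exists_max_image (Finset.Iic u) f ⟨u, by simp⟩
    exact ⟨w, by simpa using hw, fun x hx => hw' x (by simpa using hx)⟩
  choose r hr hr' using hm
  have hT : ∀ u x, a x (r u) = a x u := by
    intro u x
    rcases (hr u).eq_or_lt with h | h
    · rw [h]
    have hT : Tw a k (r u) u := by
      by_contra hn
      exact absurd (hI _ _ h hn) (not_lt.2 (hr' u u le_rfl))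
    have := hT x
    have := hA.2.2.1 x u
    have := hA.2.2.1 x (r u)
    omega
  refine ⟨fun u => f (r u), ?_, ?_⟩
  · intro u v s hs hsk
    rw [← hf (r u) (r v) s hs hsk, hT, hA.1 (r u) v, hT, hA.1]
  · intro u v huv
    exact hr' v _ ((hr u).trans huv)

/-- weight of a walk -/
def wt {n : ℕ} (w : Fin n → Fin n → ℝ) : List (Fin n) → ℝ
  | [] => 0
  | [_] => 0
  | x :: y :: l => w x y + wt w (y :: l)

lemma dot_zero (k : ℕ) (d : ℕ → ℝ) : dotProd k 0 d = 0 := by simp [dotProd]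

lemma dot_add (k : ℕ) (b c : ℕ → ℤ) (d : ℕ → ℝ) :
    dotProd k (b + c) d = dotProd k b d + dotProd k c d := by
  simp [dotProd, add_mul, Finset.sum_add_distrib]

lemma dot_neg (k : ℕ) (b : ℕ → ℤ) (d : ℕ → ℝ) : dotProd k (-b) d = - dotProd k b d := by
  simp [dotProd]

lemma dot_chi {k t : ℕ} (d : ℕ → ℝ) (h1 : 1 ≤ t) (h2 : t ≤ k) : dotProd k (chi t) d = d t := by
  simp [dotProd, chi, h1, h2]

lemma dot_P {n : ℕ} (k : ℕ) (a : Fin n → Fin n → ℕ) (d : ℕ → ℝ) (l : List (Fin n)) :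
    dotProd k (betaPWalk k a l) d = wt (fun x y => dotProd k (betaP k a x y) d) l := by
  induction l with
  | nil => simp [betaPWalk, wt, dot_zero]
  | cons x l ih =>
    cases l with
    | nil => simp [betaPWalk, wt, dot_zero]
    | cons y l =>
      simp only [betaPWalk, wt, List.tail_cons, List.zip_cons_cons, List.map_cons, List.sum_cons,
        dot_add] at ih ⊢
      rw [ih]

lemma dot_M {n : ℕ} (k : ℕ) (a : Fin n → Fin n → ℕ) (d : ℕ → ℝ) (l : List (Fin n)) :
    dotProd k (betaMWalk k a l) d = wt (fun x y => dotProd k (betaM k a x y) d) l := by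
  induction l with
  | nil => simp [betaMWalk, wt, dot_zero]
  | cons x l ih =>
    cases l with
    | nil => simp [betaMWalk, wt, dot_zero]
    | cons y l =>
      simp only [betaMWalk, wt, List.tail_cons, List.zip_cons_cons, List.map_cons, List.sum_cons,
        dot_add] at ih ⊢
      rw [ih]

lemma wt_split {n : ℕ} (w : Fin n → Fin n → ℝ) (l1 l2 : List (Fin n)) (x : Fin n) :
    wt w (l1 ++ x :: l2) = wt w (l1 ++ [x]) + wt w (x :: l2) := by
  induction l1 with
  | nil => simp [wt]
  | cons y l ih =>
    cases l with
    | nil => simp [wt]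
    | cons z l =>
      simp only [List.cons_append, wt] at ih ⊢
      rw [ih]; ring

lemma wt_reverse {n : ℕ} (w : Fin n → Fin n → ℝ) (l : List (Fin n)) :
    wt w l.reverse = wt (fun x y => w y x) l := by
  induction l with
  | nil => simp [wt]
  | cons y l ih =>
    cases l with
    | nil => simp [wt]
    | cons z l =>
      simp only [List.reverse_cons, List.append_assoc, List.cons_append, List.nil_append] at ih ⊢
      rw [wt_split, ih]
      simp [wt]; ring

lemma wt_neg {n : ℕ} (w : Fin n → Fin n → ℝ) (l : List (Fin n)) :
    wt (fun x y => - w x y) l = - wt w l := by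
  induction l with
  | nil => simp [wt]
  | cons y l ih =>
    cases l with
    | nil => simp [wt]
    | cons z l => simp only [wt] at ih ⊢; rw [ih]; ring

lemma nodup_finite (n : ℕ) : Set.Finite {l : List (Fin n) | l.Nodup} := by
  refine (List.finite_length_le (Fin n) n).subset ?_
  intro l hl
  have h : l.Nodup := hl
  simpa using h.length_le_card

/-- the minimal weights of paths give a potential -/
lemma potential {n : ℕ} (R : Fin n → Fin n → Prop) (w : Fin n → Fin n → ℝ)
    (hc : ∀ x y l, R x y → l.Nodup → l.IsChain R → l.head? = some y → l.getLast? = some x →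
      0 ≤ w x y + wt w l) :
    ∃ f : Fin n → ℝ, ∀ x y, R x y → x ≠ y → f y - f x ≤ w x y := by
  classical
  have hm : ∀ v : Fin n, ∃ l : List (Fin n), (l.Nodup ∧ l.IsChain R ∧ l.head? = some v) ∧
      ∀ l' : List (Fin n), (l'.Nodup ∧ l'.IsChain R ∧ l'.head? = some v) → wt w l ≤ wt w l' := by
    intro v
    have hfin : Set.Finite {l : List (Fin n) | l.Nodup ∧ l.IsChain R ∧ l.head? = some v} := by
      apply Set.Finite.subset (s := {l : List (Fin n) | l.Nodup})
      · exact nodup_finite n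
      · exact fun l hl => hl.1
    exact Set.exists_min_image _ (wt w) hfin
      ⟨[v], show [v].Nodup ∧ [v].IsChain R ∧ [v].head? = some v by simp⟩
  choose L hL hmin using hm
  refine ⟨fun v => - wt w (L v), fun x y hR hxy => ?_⟩
  obtain ⟨h1, h2, h3⟩ := hL y
  by_cases hx : x ∈ L y
  · obtain ⟨l1, l2, he⟩ := List.append_of_mem hx
    rw [he] at h1 h2 h3
    have hs := wt_split w l1 l2 x
    have e1 : (l1 ++ [x]) ++ l2 = l1 ++ x :: l2 := by simp
    have c := hc x y (l1 ++ [x]) hR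
      (by rw [← e1] at h1; exact (List.nodup_append.1 h1).1)
      (by rw [← e1] at h2; exact h2.left_of_append)
      (by cases l1 <;> simpa using h3) (by simp)
    have := hmin x (x :: l2) ⟨(List.nodup_append.1 h1).2.1, h2.right_of_append, rfl⟩
    simp only [he]
    linarith
  · obtain ⟨l', hl'⟩ : ∃ l', L y = y :: l' := by
      cases hl : L y with
      | nil => rw [hl] at h3; simp at h3
      | cons z l' => rw [hl] at h3; simp at h3; exact ⟨l', by rw [h3]⟩
    have := hmin x (x :: L y) ⟨List.nodup_cons.2 ⟨hx, h1⟩, by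
      rw [hl'] at h2 ⊢; exact List.isChain_cons_cons.2 ⟨hR, h2⟩, rfl⟩
    rw [hl'] at this
    simp only [wt] at this
    simp only [hl']
    linarith

lemma wt_continuous {n : ℕ} (w : ℝ → Fin n → Fin n → ℝ) (hw : ∀ x y, Continuous fun e => w e x y)
    (l : List (Fin n)) : Continuous fun e => wt (w e) l := by
  induction l with
  | nil => simpa [wt] using continuous_const
  | cons y l ih =>
    cases l with
    | nil => simpa [wt] using continuous_const
    | cons z l => simp only [wt] at ih ⊢; exact (hw _ _).add ih

lemma betaM_swap {n k : ℕ} {a : Fin n → Fin n → ℕ} (hA : IsRobinson n k a) (x y : Fin n) :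
    betaM k a y x = - betaP k a x y := by
  unfold betaM betaP
  rcases lt_trichotomy x y with h | h | h
  · simp [h, h.not_gt, hA.1 y x]
  · simp [h]
  · simp only [h, h.not_gt, if_true, if_false, hA.1 y x]
    split_ifs <;> simp

/-- the weight of a step of an upper-bound-walk -/
lemma pw_up {n k : ℕ} {a : Fin n → Fin n → ℕ} (hA : IsRobinson n k a) (d : ℕ → ℝ) {x y : Fin n}
    (h : x < y) (h1 : 1 ≤ a x y) : dotProd k (betaP k a x y) d = d (a x y) := by
  simp only [betaP, h, if_true]
  exact dot_chi d h1 (hA.2.2.1 _ _)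

lemma pw_down {n k : ℕ} {a : Fin n → Fin n → ℕ} (d : ℕ → ℝ) {x y : Fin n}
    (h : y < x) (h1 : a x y < k) : dotProd k (betaP k a x y) d = - d (a x y + 1) := by
  simp only [betaP, h, h.not_gt, h1.ne, if_true, if_false]
  rw [dot_neg, dot_chi d (by omega) (by omega)]

lemma pw_down' {n k : ℕ} {a : Fin n → Fin n → ℕ} (d : ℕ → ℝ) {x y : Fin n}
    (h : y < x) (h1 : a x y = k) : dotProd k (betaP k a x y) d = 0 := by
  simp only [betaP, h, h.not_gt, h1, if_true, if_false]
  exact dot_zero _ _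

lemma cycle_pos {n k : ℕ} {a : Fin n → Fin n → ℕ} {d : ℕ → ℝ} (hA : IsRobinson n k a)
    (hP : PathCondition n k a d) (x y : Fin n) (l : List (Fin n))
    (hR : x ≠ y ∧ (x < y → 1 ≤ a x y)) (hn : l.Nodup)
    (hch : l.IsChain (fun x y => x ≠ y ∧ (x < y → 1 ≤ a x y)))
    (hh : l.head? = some y) (hl : l.getLast? = some x) :
    0 < dotProd k (betaP k a x y) d + wt (fun x y => dotProd k (betaP k a x y) d) l := by
  rcases lt_or_gt_of_ne hR.1 with h | h
  · have := hP x y h [x, y] l.reverse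
      ⟨rfl, rfl, List.isChain_pair.2 hR⟩ (by simp [h.ne])
      ⟨by simpa using hl, by simpa using hh, by
        change List.IsChain _ _
        rw [List.isChain_reverse]
        refine hch.imp ?_
        intro p q hpq
        refine ⟨hpq.1.symm, fun hlt => ?_⟩
        rw [hA.1]
        exact hpq.2 hlt⟩ (List.nodup_reverse.2 hn)
    rw [dot_M, dot_P, wt_reverse] at this
    simp only [betaM_swap hA, dot_neg, wt_neg] at this
    simp only [wt] at this
    linarith
  · have := hP y x h l [y, x] ⟨hh, hl, hch⟩ hn
      ⟨rfl, rfl, List.isChain_pair.2 ⟨h.ne, fun h' => absurd h' h.not_gt⟩⟩ (by simp [h.ne])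
    rw [dot_M, dot_P] at this
    simp only [wt, betaM_swap hA, dot_neg] at this
    linarith

open Filter Topology in
lemma backward {n k : ℕ} (hk : 1 ≤ k) {a : Fin n → Fin n → ℕ} {d : ℕ → ℝ} (hA : IsRobinson n k a)
    (hd : IsThreshold k d) (hP : PathCondition n k a d) : ∃ f, Emb n k a d f := by
  classical
  let w : ℝ → Fin n → Fin n → ℝ := fun e x y =>
    dotProd k (betaP k a x y) d - if y < x ∧ a x y < k then e else 0
  have hw : ∀ x y, Continuous fun e => w e x y := by
    intro x y
    simp only [w]
    split_ifs <;> fun_prop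
  let R : Fin n → Fin n → Prop := fun x y => x ≠ y ∧ (x < y → 1 ≤ a x y)
  have hw0 : w 0 = fun x y => dotProd k (betaP k a x y) d := by
    funext x y; simp [w]
  have hfin : Set.Finite {p : (Fin n × Fin n) × List (Fin n) | p.2.Nodup} := by
    have h1 : Set.Finite {l : List (Fin n) | l.Nodup} := nodup_finite n
    refine (Set.Finite.prod (Set.finite_univ (α := Fin n × Fin n)) h1).subset ?_
    intro p hp
    exact ⟨trivial, hp⟩
  have hev : ∀ᶠ e in 𝓝 (0 : ℝ), ∀ p ∈ {p : (Fin n × Fin n) × List (Fin n) | p.2.Nodup},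
      (R p.1.1 p.1.2 ∧ p.2.IsChain R ∧ p.2.head? = some p.1.2 ∧ p.2.getLast? = some p.1.1) →
      0 < w e p.1.1 p.1.2 + wt (w e) p.2 := by
    rw [Filter.eventually_all_finite hfin]
    rintro ⟨⟨x, y⟩, l⟩ hn
    by_cases hh : R x y ∧ l.IsChain R ∧ l.head? = some y ∧ l.getLast? = some x
    · have hpos := cycle_pos hA hP x y l hh.1 hn hh.2.1 hh.2.2.1 hh.2.2.2
      have hcont : Continuous fun e => w e x y + wt (w e) l := (hw x y).add (wt_continuous w hw l)
      have : (0 : ℝ) < w 0 x y + wt (w 0) l := by rw [hw0]; exact hpos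
      filter_upwards [hcont.continuousAt.eventually (lt_mem_nhds this)] with e he _
      exact he
    · exact Eventually.of_forall fun e h => absurd h hh
  obtain ⟨e, he, hepos⟩ := ((hev.filter_mono nhdsWithin_le_nhds).and
    (self_mem_nhdsWithin : Set.Ioi (0 : ℝ) ∈ 𝓝[>] 0)).exists
  obtain ⟨f, hf⟩ := potential R (w e) (fun x y l h1 h2 h3 h4 h5 =>
    (he ((x, y), l) h2 ⟨h1, h3, h4, h5⟩).le)
  have hepos : 0 < e := hepos
  refine ⟨f, ?_⟩
  have key : ∀ u v, u < v → ∀ s, 1 ≤ s → s ≤ k → (s ≤ a u v ↔ |f v - f u| ≤ d s) := by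
    intro u v huv s hs hsk
    have hak := hA.2.2.1 u v
    have hdown := hf v u ⟨huv.ne', fun h => absurd h huv.not_gt⟩ huv.ne'
    have hnn : 0 ≤ f v - f u := by
      rcases hak.eq_or_lt with hh | hh
      · simp only [w, hA.1 v u, hh, lt_irrefl, and_false, if_false] at hdown
        rw [pw_down' d huv (by rw [hA.1, hh])] at hdown
        linarith
      · simp only [w, hA.1 v u, hh, huv, and_self, if_true] at hdown
        rw [pw_down d huv (by rw [hA.1]; exact hh)] at hdown
        have := thr_pos hd (i := a v u + 1) (by omega) (by rw [hA.1]; omega)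
        linarith
    rw [abs_of_nonneg hnn]
    constructor
    · intro h
      have hup := hf u v ⟨huv.ne, fun _ => by omega⟩ huv.ne
      simp only [w, huv.not_gt, false_and, if_false] at hup
      rw [pw_up hA d huv (by omega)] at hup
      have := thr_anti_s1 hd hs h hak
      linarith
    · intro h
      by_contra hcon
      have hh : a u v < k := by omega
      simp only [w, hA.1 v u, hh, huv, and_self, if_true] at hdown
      rw [pw_down d huv (by rw [hA.1]; exact hh), hA.1 v u] at hdown
      have := thr_anti_s1 hd (i := a u v + 1) (j := s) (by omega) (by omega) hsk
      linarith
  intro u v s hs hsk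
  rcases lt_trichotomy u v with h | h | h
  · exact key u v h s hs hsk
  · subst h
    simp [hA.2.1, hsk, (thr_pos hd hs hsk).le]
  · rw [hA.1, abs_sub_comm]
    exact key v u h s hs hsk

lemma walk_upper {n : ℕ} (R : Fin n → Fin n → Prop) (w : Fin n → Fin n → ℝ) (g : Fin n → ℝ)
    (h1 : ∀ x y, R x y → x ≠ y ∧ g y - g x ≤ w x y) (h2 : ∀ x y, R x y → x < y → g y - g x < w x y)
    (l : List (Fin n)) : ∀ u v, l.IsChain R → l.head? = some u → l.getLast? = some v →
      g v - g u ≤ wt w l ∧ (u < v → g v - g u < wt w l) := by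
  induction l with
  | nil => intro u v _ h; simp at h
  | cons x l ih =>
    cases l with
    | nil =>
      intro u v _ hu hv
      simp at hu hv
      subst hu; subst hv
      simp [wt]
    | cons y l =>
      intro u v hc hu hv
      simp at hu
      subst hu
      rw [List.isChain_cons_cons] at hc
      obtain ⟨e1, e2⟩ := ih y v hc.2 rfl (by simpa [List.getLast?_cons_cons] using hv)
      obtain ⟨b0, b1⟩ := h1 x y hc.1
      simp only [wt] at e1 e2 ⊢
      refine ⟨by linarith, fun hxv => ?_⟩
      rcases lt_or_gt_of_ne b0 with h | h
      · have := h2 x y hc.1 h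
        linarith
      · have := e2 (h.trans hxv)
        linarith

open Filter Topology in
lemma forward {n k : ℕ} (hk : 1 ≤ k) {a : Fin n → Fin n → ℕ} {d : ℕ → ℝ} (hA : IsRobinson n k a)
    (hd : IsThreshold k d) (hE : ∃ f, Emb n k a d f) :
    ∃ d, IsThreshold k d ∧ PathCondition n k a d := by
  obtain ⟨g, hg, hm⟩ := exists_mono hA hd hE
  have hev : ∀ᶠ e in 𝓝 (0 : ℝ), ∀ u v : Fin n, ∀ s ∈ Set.Icc 1 k, a u v < s →
      d s + e < |g v - g u| := by
    rw [eventually_all]; intro u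
    rw [eventually_all]; intro v
    rw [eventually_all_finite (Set.finite_Icc 1 k)]
    intro s hs
    by_cases h : a u v < s
    · have h' := not_le.1 ((hg u v s hs.1 hs.2).not.1 (by omega))
      have hcont : Continuous fun e : ℝ => d s + e := by fun_prop
      have h0 : d s + 0 < |g v - g u| := by simpa using h'
      filter_upwards [hcont.continuousAt.eventually (gt_mem_nhds h0)] with e he _
      exact he
    · exact Eventually.of_forall fun e h' => absurd h' h
  obtain ⟨e, he, hepos⟩ := ((hev.filter_mono nhdsWithin_le_nhds).and
    (self_mem_nhdsWithin : Set.Ioi (0 : ℝ) ∈ 𝓝[>] 0)).exists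
  have hepos : 0 < e := hepos
  refine ⟨fun s => d s + e, ⟨fun i h1 h2 => by have := hd.1 i h1 h2; simp only; linarith,
    by have := hd.2; simp only; linarith⟩, ?_⟩
  have up : ∀ x y, x < y → 1 ≤ a x y →
      g y - g x < dotProd k (betaP k a x y) (fun s => d s + e) := by
    intro x y hxy h1
    rw [pw_up hA _ hxy h1]
    have := (hg x y (a x y) h1 (hA.2.2.1 _ _)).1 le_rfl
    have := (abs_le.1 this).2
    linarith
  have down : ∀ x y, y < x →
      g y - g x ≤ dotProd k (betaP k a x y) (fun s => d s + e) := by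
    intro x y hxy
    have hmono := hm y x hxy.le
    rcases (hA.2.2.1 x y).eq_or_lt with h | h
    · rw [pw_down' _ hxy h]; linarith
    · rw [pw_down _ hxy h]
      have := he x y (a x y + 1) ⟨by omega, by omega⟩ (by omega)
      rw [abs_sub_comm, abs_of_nonneg (by linarith)] at this
      linarith
  have step : ∀ x y : Fin n, (x ≠ y ∧ (x < y → 1 ≤ a x y)) → x ≠ y ∧
      g y - g x ≤ dotProd k (betaP k a x y) (fun s => d s + e) := by
    intro x y h
    refine ⟨h.1, ?_⟩
    rcases lt_or_gt_of_ne h.1 with h' | h'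
    · exact (up x y h' (h.2 h')).le
    · exact down x y h'
  intro u v huv w1 w2 hU _ hL _
  have b1 := (walk_upper _ _ g step (fun x y h h' => up x y h' (h.2 h')) w1 u v
    hU.2.2 hU.1 hU.2.1).2 huv
  have b2 := (walk_upper _ _ g step (fun x y h h' => up x y h' (h.2 h')) w2.reverse v u
    (by
      rw [List.isChain_reverse]
      have hc : List.IsChain _ w2 := hL.2.2
      refine hc.imp ?_
      intro p q hpq
      refine ⟨hpq.1.symm, fun hlt => ?_⟩
      rw [hA.1]
      exact hpq.2 hlt) (by simpa using hL.2.1) (by simpa using hL.1)).1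
  rw [wt_reverse] at b2
  rw [dot_M, dot_P]
  have e2 : wt (fun x y => dotProd k (betaM k a x y) (fun s => d s + e)) w2 =
      - wt (fun x y => dotProd k (betaP k a y x) (fun s => d s + e)) w2 := by
    rw [← wt_neg]
    simp only [betaM_swap hA, dot_neg]
  rw [e2]
  linarith

/-- Theorem 2, the main theorem: a Robinson matrix `A ∈ 𝒮ⁿ[k]` has a
uniform embedding with respect to some threshold vector if and only if there exists
`d ∈ 𝔻ᵏ` satisfying the path condition for `A`. -/
theorem statement1 (n k : ℕ) (hn : 1 ≤ n) (hk : 1 ≤ k) (a : Fin n → Fin n → ℕ)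
    (hA : IsRobinson n k a) :
    (∃ (d : ℕ → ℝ) (f : Fin n → ℝ), IsThreshold k d ∧ IsUnifEmb n k a d f) ↔
      ∃ d : ℕ → ℝ, IsThreshold k d ∧ PathCondition n k a d := by
  constructor
  · rintro ⟨d, f, hd, hf⟩
    exact forward hk hA hd ⟨f, (emb_iff hA hd).1 hf⟩
  · rintro ⟨d, hd, hP⟩
    obtain ⟨f, hf⟩ := backward hk hA hd hP
    exact ⟨d, f, hd, (emb_iff hA hd).2 hf⟩
end
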